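/- Assume either 1 < α < 2 with 1 < βᵢ < 1/(α−1) for i = 1,2 and 1/β₁ + 1/β₂ < α, or 0 < α ≤ 1 with βᵢ > 1/α for i = 1,2 and 1/β₁ + 1/β₂ < α. Let (m_n) be a sequence of positive integers with m_n → ∞ and m_n^{−β₂}/n^{−β₁} → ∞ as n → ∞. Then lim_{n→∞} ρ(n,−m_n)/(n^{1−β₁α} m_n^{−β₂/β₁}) = Σ_{j=0}^∞ ∫₀^∞ V(u^{−β₁}, w_{(∞,j)} (1+j)^{−β₂}) du. -/

import Mathlib

open Filter MeasureTheory Real Set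

/-- The kernel `V(x,y) = xy/(x^2+y^2)^{(2-α)/2}` with `V(0,0)=0`. -/
noncomputable def V (α : ℝ) : ℝ → ℝ → ℝ := fun x y =>
  if x = 0 ∧ y = 0 then 0 else x * y / (x ^ 2 + y ^ 2) ^ ((2 - α) / 2)

lemma V_comm' (α x y : ℝ) : V α x y = V α y x := by
  unfold V
  by_cases h : x = 0 ∧ y = 0
  · simp [h.1, h.2]
  · have h' : ¬ (y = 0 ∧ x = 0) := fun k => h ⟨k.2, k.1⟩
    rw [if_neg h, if_neg h', mul_comm, add_comm]

lemma V_hom (α t x y : ℝ) (ht : 0 < t) : V α (t * x) (t * y) = t ^ α * V α x y := by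
  unfold V
  by_cases h : x = 0 ∧ y = 0
  · simp [h.1, h.2]
  · have h' : ¬ (t * x = 0 ∧ t * y = 0) := by
      rintro ⟨k1, k2⟩
      exact h ⟨by simpa [ht.ne'] using k1, by simpa [ht.ne'] using k2⟩
    rw [if_neg h, if_neg h']
    have e : (t * x) ^ 2 + (t * y) ^ 2 = t ^ 2 * (x ^ 2 + y ^ 2) := by ring
    have e2 : (t ^ 2) ^ ((2 - α) / 2) = t ^ (2 - α) := by
      rw [← Real.rpow_natCast, ← Real.rpow_mul ht.le]; congr 1; push_cast; ring
    have e3 : t ^ (2 - α) * t ^ α = t * t := by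
      rw [← Real.rpow_add ht, show 2 - α + α = (2 : ℕ) by push_cast; ring, Real.rpow_natCast]; ring
    have pos : 0 < x ^ 2 + y ^ 2 := by
      by_cases hx : x = 0
      · have : y ≠ 0 := fun k => h ⟨hx, k⟩
        positivity
      · positivity
    rw [e, Real.mul_rpow (by positivity) pos.le, e2]
    have p1 : 0 < t ^ (2 - α) := Real.rpow_pos_of_pos ht _
    have p2 : 0 < (x ^ 2 + y ^ 2) ^ ((2 - α) / 2) := Real.rpow_pos_of_pos pos _
    rw [mul_div_assoc', div_eq_div_iff (by positivity) (by positivity)]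
    linear_combination (- x * y * (x ^ 2 + y ^ 2) ^ ((2 - α) / 2)) * e3

lemma V_bound (α s x y : ℝ) (h1 : s ≤ 1) (h2 : α - 1 ≤ s) :
    |V α x y| ≤ |x| ^ s * |y| ^ (α - s) := by
  unfold V
  by_cases hx : x = 0
  · simp [hx]; positivity
  by_cases hy : y = 0
  · simp [hy]; positivity
  rw [if_neg (fun k => hx k.1)]
  have px : 0 < |x| := abs_pos.mpr hx
  have py : 0 < |y| := abs_pos.mpr hy
  have pos : 0 < x ^ 2 + y ^ 2 := by positivity
  have p2 : 0 < (x ^ 2 + y ^ 2) ^ ((2 - α) / 2) := Real.rpow_pos_of_pos pos _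
  rw [abs_div, abs_mul, abs_of_pos p2, div_le_iff₀ p2]
  have key : ∀ z e : ℝ, z ≠ 0 → 0 ≤ e → z ^ 2 ≤ x ^ 2 + y ^ 2 →
      |z| ^ e ≤ (x ^ 2 + y ^ 2) ^ (e / 2) := by
    intro z e hz he hle
    have : |z| ^ e = (z ^ 2) ^ (e / 2) := by
      rw [← sq_abs, ← Real.rpow_natCast, ← Real.rpow_mul (abs_nonneg z)]; congr 1; push_cast; ring
    rw [this]
    exact Real.rpow_le_rpow (by positivity) hle (by linarith)
  have k1 := key x (1 - s) hx (by linarith) (by nlinarith [sq_nonneg y])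
  have k2 := key y (1 - α + s) hy (by linarith) (by nlinarith [sq_nonneg x])
  have k3 : |x| = |x| ^ s * |x| ^ (1 - s) := by
    rw [← Real.rpow_add px]; simp
  have k4 : |y| = |y| ^ (α - s) * |y| ^ (1 - α + s) := by
    rw [← Real.rpow_add py]; ring_nf; simp
  have k5 : (x ^ 2 + y ^ 2) ^ ((2 - α) / 2) =
      (x ^ 2 + y ^ 2) ^ ((1 - s) / 2) * (x ^ 2 + y ^ 2) ^ ((1 - α + s) / 2) := by
    rw [← Real.rpow_add pos]; congr 1; ring
  calc |x| * |y| = (|x| ^ s * |y| ^ (α - s)) * (|x| ^ (1 - s) * |y| ^ (1 - α + s)) := by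
        conv_lhs => rw [k3, k4]
        ring
    _ ≤ _ := by
        rw [k5]; gcongr

lemma V_tendsto (α : ℝ) {ι : Type*} {l : Filter ι} {f g : ι → ℝ} {x y : ℝ} (hx : 0 < x)
    (hf : Tendsto f l (nhds x)) (hg : Tendsto g l (nhds y)) :
    Tendsto (fun n => V α (f n) (g n)) l (nhds (V α x y)) := by
  have e : ∀ᶠ n in l, f n * g n / (f n ^ 2 + g n ^ 2) ^ ((2 - α) / 2) = V α (f n) (g n) := by
    filter_upwards [hf.eventually (lt_mem_nhds hx)] with n hn
    unfold V
    rw [if_neg (fun k => hn.ne' k.1)]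
  refine Tendsto.congr' e ?_
  unfold V
  rw [if_neg (fun k => hx.ne' k.1)]
  have pos : 0 < x ^ 2 + y ^ 2 := by positivity
  refine (hf.mul hg).div (((hf.pow 2).add (hg.pow 2)).rpow_const (Or.inl pos.ne')) ?_
  exact (Real.rpow_pos_of_pos pos _).ne'

lemma floor_sum (f : ℕ → ℝ) (hf : Summable f) :
    ∫ s in Ioi (0 : ℝ), f ⌊s⌋₊ = ∑' i, f i := by
  have hU : (⋃ i : ℕ, Ico (i : ℝ) (i + 1)) = Ici (0 : ℝ) := by
    ext x
    simp only [mem_iUnion, mem_Ico, mem_Ici]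
    constructor
    · rintro ⟨i, h, _⟩; exact le_trans (Nat.cast_nonneg i) h
    · intro h; exact ⟨⌊x⌋₊, Nat.floor_le h, Nat.lt_floor_add_one x⟩
  have hfl : ∀ i : ℕ, ∀ s ∈ Ico (i : ℝ) (i + 1), ⌊s⌋₊ = i := fun i s hs =>
    (Nat.floor_eq_iff (le_trans (Nat.cast_nonneg i) hs.1)).2 hs
  have hdisj : Pairwise (Function.onFun Disjoint (fun i : ℕ => Ico (i : ℝ) (i + 1))) := by
    intro i j hij
    rw [Function.onFun, Set.disjoint_left]
    intro x hx hy
    exact hij ((hfl i x hx).symm.trans (hfl j x hy))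
  have hint : ∀ g : ℕ → ℝ, ∀ i : ℕ, ∫ s in Ico (i : ℝ) (i + 1), g ⌊s⌋₊ = g i := by
    intro g i
    rw [setIntegral_congr_fun measurableSet_Ico (g := fun _ => g i)
      (fun s hs => by simp only [hfl i s hs])]
    simp
  have hI : IntegrableOn (fun s : ℝ => f ⌊s⌋₊) (⋃ i : ℕ, Ico (i : ℝ) (i + 1)) := by
    refine integrableOn_iUnion_of_summable_integral_norm (fun i => ?_) ?_
    · refine IntegrableOn.congr_fun (f := fun _ => f i) ?_
        (fun s hs => by simp only [hfl i s hs]) measurableSet_Ico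
      simp
    · have := fun i => hint (fun k => ‖f k‖) i
      simp only [this]
      exact hf.norm
  rw [← integral_Ici_eq_integral_Ioi, ← hU,
    integral_iUnion (fun i => measurableSet_Ico) hdisj hI]
  simp only [hint]

lemma w_bdd (w : ℕ → ℕ → ℝ)
    (hA1 : Tendsto (fun p : ℕ × ℕ => w p.1 p.2) (atTop ×ˢ atTop) (nhds 1))
    (winf : ℕ → ℝ)
    (hA2 : ∀ i, Tendsto (fun j => w i j) atTop (nhds (winf i)))
    (wco : ℕ → ℝ)
    (hA3 : ∀ j, Tendsto (fun i => w i j) atTop (nhds (wco j))) :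
    ∃ B : ℝ, 0 < B ∧ ∀ i j, |w i j| ≤ B := by
  have h1 : ∀ᶠ p : ℕ × ℕ in atTop, |w p.1 p.2| < 2 := by
    rw [← prod_atTop_atTop_eq]
    exact hA1.abs.eventually (gt_mem_nhds (by norm_num))
  obtain ⟨⟨K, L⟩, hK⟩ := eventually_atTop.1 h1
  have h2 : ∀ i, ∃ C, ∀ j, |w i j| ≤ C := fun i => by
    obtain ⟨C, hC⟩ := (hA2 i).abs.bddAbove_range
    exact ⟨C, fun j => hC ⟨j, rfl⟩⟩
  have h3 : ∀ j, ∃ C, ∀ i, |w i j| ≤ C := fun j => by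
    obtain ⟨C, hC⟩ := (hA3 j).abs.bddAbove_range
    exact ⟨C, fun i => hC ⟨i, rfl⟩⟩
  choose C hC using h2
  choose D hD using h3
  have pC : ∀ i, 0 ≤ C i := fun i => (abs_nonneg _).trans (hC i 0)
  have pD : ∀ i, 0 ≤ D i := fun i => (abs_nonneg _).trans (hD i 0)
  have sC := Finset.sum_nonneg (s := Finset.range K) (fun i _ => pC i)
  have sD := Finset.sum_nonneg (s := Finset.range L) (fun i _ => pD i)
  refine ⟨2 + ∑ i ∈ Finset.range K, C i + ∑ j ∈ Finset.range L, D j, by linarith, fun i j => ?_⟩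
  by_cases hi : i < K
  · have := Finset.single_le_sum (s := Finset.range K) (fun i _ => pC i) (Finset.mem_range.2 hi)
    linarith [hC i j]
  by_cases hj : j < L
  · have := Finset.single_le_sum (s := Finset.range L) (fun i _ => pD i) (Finset.mem_range.2 hj)
    linarith [hD j i]
  have := hK (i, j) ⟨not_lt.1 hi, not_lt.1 hj⟩
  simp only at this
  linarith

lemma g_int (a b : ℝ) (ha : a < 1) (hb : 1 < b) :
    IntegrableOn (fun u : ℝ => if u ≤ 1 then u ^ (-a) else u ^ (-b)) (Ioi 0) := by
  rw [← Ioc_union_Ioi_eq_Ioi (zero_le_one' ℝ)]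
  refine IntegrableOn.union ?_ ?_
  · refine IntegrableOn.congr_fun (f := fun u : ℝ => u ^ (-a)) ?_
      (fun s hs => by simp only [if_pos hs.2]) measurableSet_Ioc
    rw [← intervalIntegrable_iff_integrableOn_Ioc_of_le zero_le_one]
    exact intervalIntegral.intervalIntegrable_rpow' (by linarith)
  · refine IntegrableOn.congr_fun (f := fun u : ℝ => u ^ (-b)) ?_
      (fun s hs => by simp only [if_neg (not_le.2 (mem_Ioi.1 hs))]) measurableSet_Ioi
    exact integrableOn_Ioi_rpow_of_lt (by linarith) zero_lt_one

lemma exps (α β₁ β₂ : ℝ)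
    (hcond : (1 < α ∧ α < 2 ∧ 1 < β₁ ∧ β₁ < 1 / (α - 1) ∧ 1 < β₂ ∧
        β₂ < 1 / (α - 1) ∧ 1 / β₁ + 1 / β₂ < α) ∨
      (0 < α ∧ α ≤ 1 ∧ 1 / α < β₁ ∧ 1 / α < β₂ ∧ 1 / β₁ + 1 / β₂ < α)) :
    0 < α ∧ 0 < β₁ ∧ 0 < β₂ ∧ ∃ s t : ℝ, 0 ≤ s ∧ s ≤ t ∧ t ≤ 1 ∧ α - 1 ≤ s ∧ t ≤ α ∧
      β₁ * s < 1 ∧ 1 < β₁ * t ∧ 1 < β₂ * (α - t) := by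
  have key : 0 < α ∧ 0 < β₁ ∧ 0 < β₂ ∧ 1 / β₁ < 1 ∧ α - 1 < 1 / β₁ ∧ 1 / β₁ < α - 1 / β₂ := by
    rcases hcond with ⟨h1, h2, h3, h4, h5, h6, h7⟩ | ⟨h1, h2, h3, h4, h5⟩
    · have p : 0 < β₁ := by linarith
      refine ⟨by linarith, p, by linarith, ?_, ?_, by linarith⟩
      · rw [div_lt_one p]; exact h3
      · rw [lt_div_iff₀ (by linarith)] at h4 ⊢
        linarith
    · have q : 0 < 1 / α := by positivity
      have p : 0 < β₁ := by linarith
      have r : 0 < 1 / β₁ := by positivity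
      refine ⟨h1, p, by linarith, ?_, by linarith, by linarith⟩
      rw [div_lt_one p]
      have : 1 ≤ 1 / α := by rw [le_div_iff₀ h1]; linarith
      linarith
  obtain ⟨ha, hb1, hb2, k1, k2, k3⟩ := key
  refine ⟨ha, hb1, hb2, ?_⟩
  have r : 0 < 1 / β₁ := by positivity
  have r2 : 0 < 1 / β₂ := by positivity
  obtain ⟨s, hs1, hs2⟩ := exists_between (max_lt r k2)
  obtain ⟨t, ht1, ht2⟩ := exists_between (lt_min k1 k3)
  rw [max_lt_iff] at hs1
  rw [lt_min_iff] at ht2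
  refine ⟨s, t, hs1.1.le, by linarith, ht2.1.le, hs1.2.le, by linarith, ?_, ?_, ?_⟩
  · rw [lt_div_iff₀ hb1] at hs2; linarith
  · rw [div_lt_iff₀ hb1] at ht1; linarith
  · have : 1 / β₂ < α - t := by linarith
    rw [div_lt_iff₀ hb2] at this; linarith

theorem stmt16 (α β₁ β₂ : ℝ)
    (hcond : (1 < α ∧ α < 2 ∧ 1 < β₁ ∧ β₁ < 1 / (α - 1) ∧ 1 < β₂ ∧
        β₂ < 1 / (α - 1) ∧ 1 / β₁ + 1 / β₂ < α) ∨
      (0 < α ∧ α ≤ 1 ∧ 1 / α < β₁ ∧ 1 / α < β₂ ∧ 1 / β₁ + 1 / β₂ < α))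
    (w : ℕ → ℕ → ℝ) (hw : ∀ i j, w i j ≠ 0)
    (hA1 : Tendsto (fun p : ℕ × ℕ => w p.1 p.2) (atTop ×ˢ atTop) (nhds 1))
    (winf : ℕ → ℝ)
    (hA2 : ∀ i, Tendsto (fun j => w i j) atTop (nhds (winf i)) ∧ 0 < winf i)
    (wco : ℕ → ℝ)
    (hA3 : ∀ j, Tendsto (fun i => w i j) atTop (nhds (wco j)) ∧ 0 < wco j)
    (c : ℕ → ℕ → ℝ)
    (hc : ∀ i j, c i j = w i j * (1 + (i : ℝ)) ^ (-β₁) * (1 + (j : ℝ)) ^ (-β₂))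
    (ρ : ℕ → ℕ → ℝ)
    (hsum : ∀ n m : ℕ, 1 ≤ n → 1 ≤ m →
      Summable (fun q : ℕ × ℕ => V α (c (q.1 + n) q.2) (c q.1 (q.2 + m))))
    (hρ : ∀ n m : ℕ, 1 ≤ n → 1 ≤ m →
      ρ n m = ∑' i : ℕ, ∑' j : ℕ, V α (c (i + n) j) (c i (j + m)))
    (m : ℕ → ℕ) (hm : ∀ n, 1 ≤ m n)
    (hminf : Tendsto (fun n => m n) atTop atTop)
    (hratio : Tendsto (fun n : ℕ => (m n : ℝ) ^ (-β₂) / (n : ℝ) ^ (-β₁))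
      atTop atTop)
    :
    Tendsto (fun n : ℕ => ρ n (m n) / ((n : ℝ) ^ (1 - β₁ * α) * (m n : ℝ) ^ (-(β₂ / β₁))))
      atTop
      (nhds (∑' j : ℕ, ∫ u in Ioi (0 : ℝ), V α (u ^ (-β₁)) (wco j * (1 + (j : ℝ)) ^ (-β₂)))) := by
  obtain ⟨hα, hb1, hb2, s, t, hs0, hst, ht1, hs1, htα, hbs, hbt, hb2t⟩ := exps α β₁ β₂ hcond
  obtain ⟨B, hB, hwB⟩ := w_bdd w hA1 winf (fun i => (hA2 i).1) wco (fun j => (hA3 j).1)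
  set N : ℕ → ℝ := fun n => (n : ℝ) * (m n : ℝ) ^ (-(β₂ / β₁)) with hN
  have hmpos : ∀ n, (0 : ℝ) < m n := fun n => by exact_mod_cast hm n
  have hNpos : ∀ n : ℕ, 1 ≤ n → 0 < N n := fun n hn => by
    have : (0 : ℝ) < n := by exact_mod_cast hn
    exact mul_pos this (Real.rpow_pos_of_pos (hmpos n) _)
  have hNb : ∀ n : ℕ, (N n) ^ β₁ = (n : ℝ) ^ β₁ * (m n : ℝ) ^ (-β₂) := fun n => by
    rw [hN]
    simp only
    rw [Real.mul_rpow (by positivity) (by positivity), ← Real.rpow_mul (hmpos n).le]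
    congr 2
    field_simp
  set X : ℕ → ℕ → ℕ → ℝ := fun n j i => (n : ℝ) ^ β₁ * c (i + n) j with hX
  set Y : ℕ → ℕ → ℕ → ℝ := fun n j i => (n : ℝ) ^ β₁ * c i (j + m n) with hY
  have hXe : ∀ n j i : ℕ, 1 ≤ n → X n j i =
      w (i + n) j * ((1 + (i : ℝ) + n) / n) ^ (-β₁) * (1 + (j : ℝ)) ^ (-β₂) := by
    intro n j i hn
    have pn : (0 : ℝ) < n := by exact_mod_cast hn
    simp only [hX, hc]
    rw [Real.div_rpow (by positivity) pn.le, Real.rpow_neg pn.le]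
    have : (0 : ℝ) < (n : ℝ) ^ β₁ := by positivity
    push_cast
    rw [show (1 : ℝ) + i + n = 1 + (i + n) by ring]
    field_simp
  have hYe : ∀ n j i : ℕ, 1 ≤ n → Y n j i =
      w i (j + m n) * ((1 + (i : ℝ)) / N n) ^ (-β₁) * ((1 + (j : ℝ) + m n) / m n) ^ (-β₂) := by
    intro n j i hn
    have pn : (0 : ℝ) < n := by exact_mod_cast hn
    have pm := hmpos n
    simp only [hY, hc]
    rw [Real.div_rpow (by positivity) (hNpos n hn).le, Real.rpow_neg (hNpos n hn).le, hNb,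
      Real.div_rpow (by positivity) pm.le]
    have : (0 : ℝ) < (n : ℝ) ^ β₁ := by positivity
    have : (0 : ℝ) < (m n : ℝ) ^ (-β₂) := by positivity
    push_cast
    rw [show (1 : ℝ) + j + m n = 1 + (j + m n) by ring]
    field_simp
  have hXb : ∀ n j i : ℕ, 1 ≤ n → |X n j i| ≤ B * (1 + (j : ℝ)) ^ (-β₂) := by
    intro n j i hn
    have pn : (0 : ℝ) < n := by exact_mod_cast hn
    have p1 : (0 : ℝ) < ((1 + (i : ℝ) + n) / n) ^ (-β₁) := by positivity
    have p2 : (0 : ℝ) < (1 + (j : ℝ)) ^ (-β₂) := by positivity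
    have p3 : ((1 + (i : ℝ) + n) / n) ^ (-β₁) ≤ 1 := by
      apply Real.rpow_le_one_of_one_le_of_nonpos _ (by linarith)
      rw [le_div_iff₀ pn]
      have : (0 : ℝ) ≤ i := Nat.cast_nonneg i
      linarith
    rw [hXe n j i hn, abs_mul, abs_mul, abs_of_pos p1, abs_of_pos p2]
    have : |w (i + n) j| * ((1 + (i : ℝ) + n) / n) ^ (-β₁) ≤ B * 1 :=
      mul_le_mul (hwB _ _) p3 p1.le hB.le
    rw [mul_one] at this
    exact mul_le_mul_of_nonneg_right this p2.le
  have hYb : ∀ n j : ℕ, ∀ u : ℝ, 1 ≤ n → 0 < u → |Y n j ⌊N n * u⌋₊| ≤ B * u ^ (-β₁) := by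
    intro n j u hn hu
    have pn : (0 : ℝ) < n := by exact_mod_cast hn
    have pm := hmpos n
    have pN := hNpos n hn
    have p1 : (0 : ℝ) < ((1 + (⌊N n * u⌋₊ : ℝ)) / N n) ^ (-β₁) := by positivity
    have p2 : (0 : ℝ) < ((1 + (j : ℝ) + m n) / m n) ^ (-β₂) := by positivity
    have p3 : ((1 + (j : ℝ) + m n) / m n) ^ (-β₂) ≤ 1 := by
      apply Real.rpow_le_one_of_one_le_of_nonpos _ (by linarith)
      rw [le_div_iff₀ pm]
      have : (0 : ℝ) ≤ j := Nat.cast_nonneg j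
      linarith
    have p4 : ((1 + (⌊N n * u⌋₊ : ℝ)) / N n) ^ (-β₁) ≤ u ^ (-β₁) := by
      apply Real.rpow_le_rpow_of_nonpos hu _ (by linarith)
      rw [le_div_iff₀ pN]
      have := (Nat.lt_floor_add_one (N n * u)).le
      linarith
    rw [hYe n j _ hn, abs_mul, abs_mul, abs_of_pos p1, abs_of_pos p2]
    have : |w ⌊N n * u⌋₊ (j + m n)| * ((1 + (⌊N n * u⌋₊ : ℝ)) / N n) ^ (-β₁) ≤ B * u ^ (-β₁) :=
      mul_le_mul (hwB _ _) p4 p1.le hB.le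
    have h2 := mul_le_mul this p3 p2.le (by positivity)
    rwa [mul_one] at h2
  set g : ℝ → ℝ := fun u => if u ≤ 1 then u ^ (-(β₁ * s)) else u ^ (-(β₁ * t)) with hg
  have hgint : IntegrableOn g (Ioi 0) := g_int _ _ hbs hbt
  set h : ℕ → ℝ := fun j => B ^ α * (1 + (j : ℝ)) ^ (-(β₂ * (α - t))) with hh
  have hhsum : Summable h := by
    apply Summable.mul_left
    have := (summable_nat_add_iff 1).2 (Real.summable_nat_rpow.2
      (show -(β₂ * (α - t)) < -1 by linarith))
    refine this.congr (fun j => ?_)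
    push_cast
    rw [add_comm]
  have hVb : ∀ n j : ℕ, ∀ u : ℝ, 1 ≤ n → 0 < u →
      |V α (X n j ⌊N n * u⌋₊) (Y n j ⌊N n * u⌋₊)| ≤ h j * g u := by
    intro n j u hn hu
    have hx := hXb n j ⌊N n * u⌋₊ hn
    have hy := hYb n j u hn hu
    have p2 : (0 : ℝ) < 1 + (j : ℝ) := by positivity
    have gen : ∀ r : ℝ, s ≤ r → r ≤ t →
        |V α (X n j ⌊N n * u⌋₊) (Y n j ⌊N n * u⌋₊)| ≤ h j * u ^ (-(β₁ * r)) := by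
      intro r hr1 hr2
      rw [V_comm']
      refine (V_bound α r _ _ (by linarith) (by linarith)).trans ?_
      calc _ ≤ (B * u ^ (-β₁)) ^ r * (B * (1 + (j : ℝ)) ^ (-β₂)) ^ (α - r) := by
            apply mul_le_mul
            · exact Real.rpow_le_rpow (abs_nonneg _) hy (by linarith)
            · exact Real.rpow_le_rpow (abs_nonneg _) hx (by linarith)
            · positivity
            · positivity
        _ = (B ^ α * (1 + (j : ℝ)) ^ (-(β₂ * (α - r)))) * u ^ (-(β₁ * r)) := by
            rw [Real.mul_rpow hB.le (by positivity), Real.mul_rpow hB.le (by positivity),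
              ← Real.rpow_mul hu.le, ← Real.rpow_mul p2.le,
              show B ^ α = B ^ r * B ^ (α - r) by rw [← Real.rpow_add hB]; congr 1; ring,
              neg_mul, neg_mul]
            ring
        _ ≤ _ := by
            rw [hh]
            apply mul_le_mul_of_nonneg_right _ (by positivity)
            apply mul_le_mul_of_nonneg_left _ (by positivity)
            apply Real.rpow_le_rpow_of_exponent_le
            · have : (0 : ℝ) ≤ j := Nat.cast_nonneg j
              linarith
            · have : β₂ * (α - t) ≤ β₂ * (α - r) :=
                mul_le_mul_of_nonneg_left (by linarith) hb2.le
              linarith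
    simp only [hg]
    split_ifs
    · exact gen s le_rfl hst
    · exact gen t hst le_rfl
  -- identity
  have hE : ∀ n : ℕ, 1 ≤ n →
      ρ n (m n) / ((n : ℝ) ^ (1 - β₁ * α) * (m n : ℝ) ^ (-(β₂ / β₁))) =
      ∑' j : ℕ, ∫ u in Ioi (0 : ℝ), V α (X n j ⌊N n * u⌋₊) (Y n j ⌊N n * u⌋₊) := by
    intro n hn
    have pn : (0 : ℝ) < n := by exact_mod_cast hn
    have pm := hmpos n
    have pN := hNpos n hn
    have hs := hsum n (m n) hn (hm n)
    have e1 : ρ n (m n) = ∑' j : ℕ, ∑' i : ℕ, V α (c (i + n) j) (c i (j + m n)) := by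
      rw [hρ n (m n) hn (hm n)]
      exact (Summable.tsum_comm (f := fun i j => V α (c (i + n) j) (c i (j + m n))) hs).symm
    rw [e1, ← tsum_div_const]
    congr 1
    ext j
    have hsj : Summable (fun i : ℕ => V α (c (i + n) j) (c i (j + m n))) :=
      hs.comp_injective (i := fun i : ℕ => (i, j)) (fun a b hab => (Prod.mk.inj hab).1)
    have e2 : ∀ i : ℕ, V α (X n j i) (Y n j i) =
        (n : ℝ) ^ (β₁ * α) * V α (c (i + n) j) (c i (j + m n)) := fun i => by
      rw [hX, hY]
      simp only
      rw [V_hom _ _ _ _ (by positivity), Real.rpow_mul pn.le]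
    have hsj2 : Summable (fun i : ℕ => V α (X n j i) (Y n j i)) := by
      simp only [e2]; exact hsj.mul_left _
    have e3 := integral_comp_mul_left_Ioi (fun s : ℝ => V α (X n j ⌊s⌋₊) (Y n j ⌊s⌋₊)) 0 pN
    rw [e3, mul_zero, floor_sum (fun i => V α (X n j i) (Y n j i)) hsj2]
    simp only [e2]
    rw [tsum_mul_left, smul_eq_mul, Real.rpow_sub pn, Real.rpow_one, hN]
    have : (0 : ℝ) < (n : ℝ) ^ (β₁ * α) := by positivity
    have : (0 : ℝ) < (m n : ℝ) ^ (-(β₂ / β₁)) := by positivity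
    field_simp
  have hge : ∀ᶠ n : ℕ in atTop, 1 ≤ n := eventually_ge_atTop 1
  have hncast : Tendsto (fun n : ℕ => (n : ℝ)) atTop atTop := tendsto_natCast_atTop_atTop
  have hmcast : Tendsto (fun n : ℕ => (m n : ℝ)) atTop atTop :=
    tendsto_natCast_atTop_atTop.comp hminf
  have hNinf : Tendsto N atTop atTop := by
    have h1 : Tendsto (fun n => ((m n : ℝ) ^ (-β₂) / (n : ℝ) ^ (-β₁)) ^ (1 / β₁)) atTop atTop :=
      (tendsto_rpow_atTop (by positivity)).comp hratio
    refine h1.congr' ?_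
    filter_upwards [hge] with n hn
    have pn : (0 : ℝ) < n := by exact_mod_cast hn
    rw [Real.rpow_neg pn.le, div_inv_eq_mul, mul_comm, ← hNb, ← Real.rpow_mul (hNpos n hn).le,
      mul_one_div_cancel hb1.ne', Real.rpow_one]
  have hNn : Tendsto (fun n => N n / n) atTop (nhds 0) := by
    have h1 : Tendsto (fun n => (m n : ℝ) ^ (-(β₂ / β₁))) atTop (nhds 0) :=
      (tendsto_rpow_neg_atTop (by positivity)).comp hmcast
    refine h1.congr' ?_
    filter_upwards [hge] with n hn
    have pn : (0 : ℝ) < n := by exact_mod_cast hn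
    rw [hN]
    field_simp
  have hfl : ∀ u : ℝ, 0 < u → Tendsto (fun n => (⌊N n * u⌋₊ : ℝ) / N n) atTop (nhds u) := by
    intro u hu
    have := (tendsto_nat_floor_mul_div_atTop hu.le).comp hNinf
    refine this.congr (fun n => ?_)
    simp [mul_comm]
  have hflinf : ∀ u : ℝ, 0 < u → Tendsto (fun n => ⌊N n * u⌋₊) atTop atTop := fun u hu =>
    tendsto_nat_floor_atTop.comp (hNinf.atTop_mul_const hu)
  have hXt : ∀ j : ℕ, ∀ u : ℝ, 0 < u → Tendsto (fun n => X n j ⌊N n * u⌋₊) atTop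
      (nhds (wco j * (1 + (j : ℝ)) ^ (-β₂))) := by
    intro j u hu
    have h1 : Tendsto (fun n => w (⌊N n * u⌋₊ + n) j) atTop (nhds (wco j)) :=
      (hA3 j).1.comp (tendsto_atTop_mono (fun n => Nat.le_add_left _ _) tendsto_id)
    have h2 : Tendsto (fun n : ℕ => (1 + (⌊N n * u⌋₊ : ℝ) + n) / n) atTop (nhds 1) := by
      have h3 := ((tendsto_inv_atTop_zero.comp hncast).add ((hfl u hu).mul hNn)).add_const 1
      have : (0 : ℝ) + u * 0 + 1 = 1 := by ring
      rw [this] at h3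
      refine h3.congr' ?_
      filter_upwards [hge] with n hn
      have pn : (0 : ℝ) < n := by exact_mod_cast hn
      have pN := hNpos n hn
      simp only [Function.comp]
      field_simp
    have h4 := (h1.mul (h2.rpow_const (p := -β₁) (Or.inl one_ne_zero))).mul_const
      ((1 + (j : ℝ)) ^ (-β₂))
    rw [Real.one_rpow, mul_one] at h4
    refine h4.congr' ?_
    filter_upwards [hge] with n hn
    rw [hXe _ _ _ hn]
  have hYt : ∀ j : ℕ, ∀ u : ℝ, 0 < u → Tendsto (fun n => Y n j ⌊N n * u⌋₊) atTop
      (nhds (u ^ (-β₁))) := by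
    intro j u hu
    have h1 : Tendsto (fun n => w ⌊N n * u⌋₊ (j + m n)) atTop (nhds 1) :=
      hA1.comp (f := fun n => (⌊N n * u⌋₊, j + m n)) ((hflinf u hu).prodMk
        (tendsto_atTop_mono (fun n => Nat.le_add_left _ _) hminf))
    have h2 : Tendsto (fun n : ℕ => (1 + (j : ℝ) + m n) / m n) atTop (nhds 1) := by
      have h3 := ((tendsto_inv_atTop_zero.comp hmcast).const_mul (1 + (j : ℝ))).add_const 1
      have : (1 + (j : ℝ)) * 0 + 1 = 1 := by ring
      rw [this] at h3
      refine h3.congr' ?_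
      filter_upwards with n
      have pm := hmpos n
      simp only [Function.comp]
      field_simp
    have h5 : Tendsto (fun n : ℕ => (1 + (⌊N n * u⌋₊ : ℝ)) / N n) atTop (nhds u) := by
      have h3 := (tendsto_inv_atTop_zero.comp hNinf).add (hfl u hu)
      rw [zero_add] at h3
      refine h3.congr (fun n => ?_)
      simp only [Function.comp]
      ring
    have h4 := (h1.mul (h5.rpow_const (p := -β₁) (Or.inl hu.ne'))).mul
      (h2.rpow_const (p := -β₂) (Or.inl one_ne_zero))
    rw [Real.one_rpow, mul_one, one_mul] at h4
    refine h4.congr' ?_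
    filter_upwards [hge] with n hn
    rw [hYe _ _ _ hn]
  have hfin : Tendsto (fun n : ℕ =>
      ∑' j : ℕ, ∫ u in Ioi (0 : ℝ), V α (X n j ⌊N n * u⌋₊) (Y n j ⌊N n * u⌋₊)) atTop
      (nhds (∑' j : ℕ, ∫ u in Ioi (0 : ℝ), V α (u ^ (-β₁)) (wco j * (1 + (j : ℝ)) ^ (-β₂)))) := by
    refine tendsto_tsum_of_dominated_convergence
      (bound := fun j => h j * ∫ u in Ioi (0 : ℝ), g u) (hhsum.mul_right _) ?_ ?_
    · intro j
      refine tendsto_integral_filter_of_dominated_convergence (fun u => h j * g u) ?_ ?_ ?_ ?_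
      · filter_upwards with n
        have hmeas : Measurable (fun u : ℝ => ⌊N n * u⌋₊) :=
          Nat.measurable_floor.comp (measurable_const_mul (N n))
        exact ((measurable_from_nat (f := fun i => V α (X n j i) (Y n j i))).comp
          hmeas).aestronglyMeasurable
      · filter_upwards [hge] with n hn
        filter_upwards [ae_restrict_mem measurableSet_Ioi] with u hu
        exact hVb n j u hn hu
      · exact hgint.const_mul _
      · filter_upwards [ae_restrict_mem measurableSet_Ioi] with u hu
        have pu : 0 < u := hu
        rw [V_comm']
        refine V_tendsto α ?_ (hXt j u hu) (hYt j u hu)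
        have := (hA3 j).2
        positivity
    · filter_upwards [hge] with n hn j
      rw [← integral_const_mul]
      refine norm_integral_le_of_norm_le (hgint.const_mul _) ?_
      filter_upwards [ae_restrict_mem measurableSet_Ioi] with u hu
      exact hVb n j u hn hu
  refine hfin.congr' ?_
  filter_upwards [hge] with n hn
  exact (hE n hn).symm
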